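/- arXiv:2407.10224 — 2 statements merged into one kernel-verified Lean document; each statement's English description precedes it below -/
import Mathlib

section
/- Let T : ℕ, A, B, c, Q, D : ℝ and F, R : ℕ → ℝ. Define σ²(0) = 0 and σ²(t) = c²·∑_{m=0}^{t−1} (B·F(m))²·(∏_{i=m+1}^{t−1} (A + B·F(i))²)·2^{−2R(m)} for 1 ≤ t ≤ T, and define a(t) = c²·∑_{m=t+1}^{T} (Q + F(m)²·D)·(B·F(t))²·(∏_{j=t+1}^{m−1} (A + B·F(j))²) + F(t)²·D·c² for 0 ≤ t ≤ T (so that a(T) = F(T)²·D·c²; empty products equal 1). Then ∑_{t=0}^{T} [(Q + F(t)²·D)·σ²(t) + F(t)²·D·c²·2^{−2R(t)}] = ∑_{t=0}^{T} a(t)·2^{−2R(t)}. -/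
open Finset

/-- Rewriting the total expected LQR optimality loss
`∑_{t=0}^{T} [(Q + F t² D) σ²(t) + F t² D c² 2^(-2 R t)]`
as the weighted sum `∑_{t=0}^{T} a t · 2^(-2 R t)` of the per-stage rate terms,
where `σ²` is the accumulated error variance and
`a t = c² ∑_{m=t+1}^{T} (Q + F m² D) (B F t)² ∏_{j=t+1}^{m-1} (A + B F j)² + F t² D c²`. -/
theorem total_loss_as_weighted_rate_sum (T : ℕ) (A B c Q D : ℝ) (F R : ℕ → ℝ)
    (σsq : ℕ → ℝ)
    (hσ : ∀ t ≤ T, σsq t =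
      c ^ 2 * ∑ m ∈ Finset.range t,
        (B * F m) ^ 2 * (∏ i ∈ Finset.Ico (m + 1) t, (A + B * F i) ^ 2) *
          (2 : ℝ) ^ (-(2 : ℝ) * R m))
    (a : ℕ → ℝ)
    (ha : ∀ t ≤ T, a t =
      c ^ 2 * ∑ m ∈ Finset.Icc (t + 1) T,
        (Q + F m ^ 2 * D) * (B * F t) ^ 2 *
          (∏ j ∈ Finset.Ico (t + 1) m, (A + B * F j) ^ 2) +
        F t ^ 2 * D * c ^ 2) :
    ∑ t ∈ Finset.range (T + 1),
      ((Q + F t ^ 2 * D) * σsq t + F t ^ 2 * D * c ^ 2 * (2 : ℝ) ^ (-(2 : ℝ) * R t)) =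
    ∑ t ∈ Finset.range (T + 1), a t * (2 : ℝ) ^ (-(2 : ℝ) * R t) := by
  have loss_expand : ∀ t ∈ range (T + 1),
      (Q + F t ^ 2 * D) * σsq t + F t ^ 2 * D * c ^ 2 * (2 : ℝ) ^ (-(2 : ℝ) * R t) =
        ∑ m ∈ range t, c ^ 2 * ((Q + F t ^ 2 * D) * (B * F m) ^ 2 *
          (∏ i ∈ Ico (m + 1) t, (A + B * F i) ^ 2)) * (2 : ℝ) ^ (-(2 : ℝ) * R m) +
        F t ^ 2 * D * c ^ 2 * (2 : ℝ) ^ (-(2 : ℝ) * R t) := by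
    intro t ht
    rw [hσ t (mem_range_succ_iff.mp ht), mul_sum, mul_sum]
    congr 1
    exact sum_congr rfl fun m _ => by ring
  have weight_expand : ∀ t ∈ range (T + 1),
      a t * (2 : ℝ) ^ (-(2 : ℝ) * R t) =
        ∑ m ∈ Icc (t + 1) T, c ^ 2 * ((Q + F m ^ 2 * D) * (B * F t) ^ 2 *
          (∏ j ∈ Ico (t + 1) m, (A + B * F j) ^ 2)) * (2 : ℝ) ^ (-(2 : ℝ) * R t) +
        F t ^ 2 * D * c ^ 2 * (2 : ℝ) ^ (-(2 : ℝ) * R t) := by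
    intro t ht
    rw [ha t (mem_range_succ_iff.mp ht), add_mul, mul_sum, sum_mul]
  rw [sum_congr rfl loss_expand, sum_congr rfl weight_expand, sum_add_distrib, sum_add_distrib]
  congr 1
  refine sum_comm' fun t m => ?_
  simp only [mem_range, mem_Icc]
  omega
end

section
/- Let T : ℕ with T ≥ 2, and let A, B, c, Q, D, F, R_sum : ℝ with c ≠ 0, Q > 0, D > 0, B·F ≠ 0 and A + B·F ≠ 0. Define, for 0 ≤ t ≤ T−1, a(t) = c²·(Q + F²·D)·(B·F)²·∑_{j=0}^{T−1−t} (A + B·F)^{2j} + F²·D·c², and define the optimal rates R*(k) = (1/2)·log₂(a(k) / (∏_{i=0}^{T−1} a(i))^{1/T}) + R_sum/T for 0 ≤ k ≤ T−1. Then R* is strictly decreasing: R*(0) > R*(1) > ⋯ > R*(T−1). -/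
open Finset

/-- With a time-invariant controller, the optimal rate allocation
`R* k = (1/2) log₂(a k / (∏_{i=0}^{T-1} a i)^(1/T)) + R_sum / T`, where
`a t = c² (Q + F² D) (B F)² ∑_{j=0}^{T-1-t} (A + B F)^(2j) + F² D c²`,
is strictly decreasing: `R* 0 > R* 1 > ⋯ > R* (T-1)`. -/
theorem optimal_rates_strictly_decreasing
    (T : ℕ) (hT : 2 ≤ T) (A B c Q D F Rsum : ℝ)
    (hc : c ≠ 0) (hQ : 0 < Q) (hD : 0 < D) (hBF : B * F ≠ 0) (hABF : A + B * F ≠ 0)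
    (a : ℕ → ℝ)
    (ha : ∀ t < T, a t =
      c ^ 2 * (Q + F ^ 2 * D) * (B * F) ^ 2 *
        (∑ j ∈ Finset.range (T - t), (A + B * F) ^ (2 * j)) +
      F ^ 2 * D * c ^ 2)
    (Rstar : ℕ → ℝ)
    (hRstar : ∀ k < T, Rstar k =
      (1 / 2) * Real.logb 2 (a k / (∏ i ∈ Finset.range T, a i) ^ ((1 : ℝ) / T)) +
        Rsum / T) :
    ∀ k, k + 1 < T → Rstar (k + 1) < Rstar k := by
  intro k hk
  have hF : F ≠ 0 := right_ne_zero_of_mul hBF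
  have hgain : 0 < c ^ 2 * (Q + F ^ 2 * D) * (B * F) ^ 2 := by positivity
  have hoffset : 0 < F ^ 2 * D * c ^ 2 := by positivity
  have hterm (j : ℕ) : 0 < (A + B * F) ^ (2 * j) := by
    rw [pow_mul]
    positivity
  have hpos : ∀ t < T, 0 < a t := by
    intro t ht
    rw [ha t ht]
    exact add_pos_of_nonneg_of_pos
      (mul_nonneg hgain.le (Finset.sum_nonneg fun j _ => (hterm j).le)) hoffset
  have hlt : a (k + 1) < a k := by
    rw [ha _ hk, ha k (by omega), show T - k = T - (k + 1) + 1 by omega,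
      Finset.sum_range_succ]
    gcongr
    exact lt_add_of_pos_right _ (hterm _)
  have hprod : 0 < (∏ i ∈ Finset.range T, a i) ^ ((1 : ℝ) / T) :=
    Real.rpow_pos_of_pos (Finset.prod_pos fun i hi => hpos i (Finset.mem_range.mp hi)) _
  rw [hRstar _ hk, hRstar k (by omega)]
  have hlog := Real.logb_lt_logb one_lt_two (div_pos (hpos _ hk) hprod)
    (div_lt_div_of_pos_right hlt hprod)
  linarith
end
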